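/- Let A → B be a homomorphism of commutative rings with B ≅ A[y₁,…,y_d] a polynomial extension (more generally B flat over A), and let M be a B-module of the form M = L ⊗_ℂ ℂ[x_{m+1}, x_{m+2}, …] where L is a module over a Noetherian quotient. If restriction of M along a regular sequence of length at most m + d is computed in two steps, first an exact base change and then a Koszul-type restriction of amplitude ≤ m + d, then Tor_i^B(M, B/I) = 0 for all i > m + d, where I is the corresponding ideal. -/

import Mathlib

open CategoryTheory Limits

/-- The short complex `opcycles (k+1) ⟶ P_k ⟶ opcycles k`. -/
noncomputable def syzSC {C : Type*} [Category C] [Abelian C] (K : ChainComplex C ℕ) (k : ℕ) :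
    ShortComplex C :=
  ShortComplex.mk (K.fromOpcycles (k + 1) k) (K.pOpcycles k) (by
    rw [← cancel_epi (K.pOpcycles (k + 1))]
    simp)

lemma syzSC_shortExact {C : Type*} [Category C] [Abelian C] {X : C} (P : ProjectiveResolution X)
    (k : ℕ) : (syzSC P.complex k).ShortExact := by
  have hm : Mono (P.complex.fromOpcycles (k + 1) k) := by
    rw [Preadditive.mono_iff_cancel_zero]
    intro A g hg
    obtain ⟨A', π, hπ, x, hx⟩ := surjective_up_to_refinements_of_epi
      (P.complex.pOpcycles (k + 1)) g
    have hx0 : x ≫ P.complex.d (k + 1) k = 0 := by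
      rw [← P.complex.p_fromOpcycles, ← Category.assoc, ← hx, Category.assoc, hg, comp_zero]
    obtain ⟨A'', π', hπ', y, hy⟩ := (P.exact_succ k).exact_up_to_refinements x hx0
    have : (π' ≫ π) ≫ g = 0 := by
      rw [Category.assoc, hx, ← Category.assoc, hy]
      simp
    exact (cancel_epi (π' ≫ π)).1 (by rw [this, comp_zero])
  have hex : (ShortComplex.mk _ _ (P.complex.d_pOpcycles (k + 1) k)).Exact :=
    ShortComplex.exact_of_g_is_cokernel _ (P.complex.opcyclesIsCokernel (k + 1) k (by simp))
  refine { exact := ?_, mono_f := hm, epi_g := ?_ }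
  · let φ : ShortComplex.mk _ _ (P.complex.d_pOpcycles (k + 1) k) ⟶ syzSC P.complex k :=
      { τ₁ := P.complex.pOpcycles (k + 1)
        τ₂ := 𝟙 _
        τ₃ := 𝟙 _
        comm₁₂ := by simp [syzSC]
        comm₂₃ := by simp [syzSC] }
    have : Epi φ.τ₁ := inferInstanceAs (Epi (P.complex.pOpcycles (k + 1)))
    have : IsIso φ.τ₂ := inferInstanceAs (IsIso (𝟙 _))
    have : Mono φ.τ₃ := inferInstanceAs (Mono (𝟙 _))
    exact (ShortComplex.exact_iff_of_epi_of_isIso_of_mono φ).1 hex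
  · exact inferInstanceAs (Epi (P.complex.pOpcycles k))

lemma pd_of_iso {C : Type*} [Category C] [Abelian C] {X Y : C} (e : X ≅ Y) (n : ℕ)
    (h : HasProjectiveDimensionLT X n) : HasProjectiveDimensionLT Y n :=
  hasProjectiveDimensionLT_of_iso e n

lemma exact_map_aux {C D : Type*} [Category C] [Abelian C] [Category D] [Abelian D]
    (F : C ⥤ D) [F.Additive] [PreservesFiniteColimits F] {X₁ X₂ X₃ Z : C}
    (f : X₁ ⟶ X₂) (p : X₂ ⟶ Z) (i : Z ⟶ X₃) (r : X₃ ⟶ Z) (hr : i ≫ r = 𝟙 Z)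
    (w : f ≫ p = 0) (hc : IsColimit (CokernelCofork.ofπ p w))
    (g : X₂ ⟶ X₃) (hg : p ≫ i = g) (w' : F.map f ≫ F.map g = 0) :
    (ShortComplex.mk (F.map f) (F.map g) w').Exact := by
  have w'' : F.map f ≫ F.map p = 0 := by rw [← F.map_comp, w, F.map_zero]
  have hex : (ShortComplex.mk (F.map f) (F.map p) w'').Exact :=
    ShortComplex.exact_of_g_is_cokernel _ (CokernelCofork.mapIsColimit _ hc F)
  let φ : ShortComplex.mk (F.map f) (F.map p) w'' ⟶ ShortComplex.mk (F.map f) (F.map g) w' :=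
    { τ₁ := 𝟙 _
      τ₂ := 𝟙 _
      τ₃ := F.map i
      comm₁₂ := by simp
      comm₂₃ := by simp [← F.map_comp, hg] }
  have : Epi φ.τ₁ := inferInstanceAs (Epi (𝟙 _))
  have : IsIso φ.τ₂ := inferInstanceAs (IsIso (𝟙 _))
  have hm : F.map i ≫ F.map r = 𝟙 _ := by rw [← F.map_comp, hr, F.map_id]
  have : Mono φ.τ₃ := mono_of_mono_fac hm
  exact (ShortComplex.exact_iff_of_epi_of_isIso_of_mono φ).1 hex

lemma syz_pd {C : Type*} [Category C] [Abelian C] {X : C} (P : ProjectiveResolution X)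
    (k n : ℕ) (h : HasProjectiveDimensionLT X (n + k + 1)) :
    HasProjectiveDimensionLT (P.complex.opcycles k) (n + 1) := by
  induction k generalizing n with
  | zero =>
    exact pd_of_iso
      (IsColimit.coconePointUniqueUpToIso P.isColimitCokernelCofork
        (P.complex.opcyclesIsCokernel 1 0 (by simp))) _ h
  | succ k ih =>
    have h2 := ih (n + 1) (by convert h using 1; omega)
    exact ((syzSC_shortExact P k).hasProjectiveDimensionLT_X₃_iff n (P.projective k)).1 h2

lemma isZero_leftDerived_of_pd {C D : Type*} [Category C] [Abelian C] [Category D] [Abelian D]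
    [HasProjectiveResolutions C]
    (F : C ⥤ D) [F.Additive] [PreservesFiniteColimits F] (X : C) (k : ℕ)
    (h : HasProjectiveDimensionLT X (k + 1)) :
    IsZero ((F.leftDerived (k + 1)).obj X) := by
  let P := projectiveResolution X
  refine IsZero.of_iso ?_ (P.isoLeftDerivedObj F (k + 1))
  erw [← HomologicalComplex.exactAt_iff_isZero_homology]
  rw [HomologicalComplex.exactAt_iff' _ (k + 2) (k + 1) k
    (by simp only [ChainComplex.prev]; rfl) (by simp)]
  have h0 := syz_pd P k 0 (by simpa using h)
  have hp : Projective (syzSC P.complex k).X₃ :=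
    (projective_iff_hasProjectiveDimensionLT_one).2 h0
  have hS := (syzSC_shortExact P k)
  have := hS.epi_g
  let s := ShortComplex.Splitting.ofExactOfSection _ hS.exact
    (Projective.factorThru (𝟙 _) (syzSC P.complex k).g) (by simp) hS.mono_f
  exact exact_map_aux F (P.complex.d (k + 2) (k + 1)) (P.complex.pOpcycles (k + 1))
    (P.complex.fromOpcycles (k + 1) k) s.r s.f_r (P.complex.d_pOpcycles _ _)
    (P.complex.opcyclesIsCokernel (k + 2) (k + 1) (by simp)) (P.complex.d (k + 1) k)
    (P.complex.p_fromOpcycles _ _) _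

lemma pd_quot_regular {B : Type} [CommRing B] (rs : List B) (n : ℕ) (M : ModuleCat.{0} B)
    (hM : HasProjectiveDimensionLT M (n + 1))
    (reg : RingTheory.Sequence.IsWeaklyRegular M rs) :
    HasProjectiveDimensionLT
      (ModuleCat.of B (M ⧸ Ideal.ofList rs • (⊤ : Submodule B M))) (n + rs.length + 1) := by
  induction rs generalizing M n with
  | nil =>
    refine pd_of_iso
      (Submodule.quotEquivOfEqBot _ (by rw [Ideal.ofList_nil, Submodule.bot_smul])).symm.toModuleIso _ hM
  | cons x rs ih =>
    rw [RingTheory.Sequence.isWeaklyRegular_cons_iff] at reg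
    have h1 : HasProjectiveDimensionLT (ModuleCat.of B (QuotSMulTop x M)) (n + 1 + 1) :=
      reg.1.smulShortComplex_shortExact.hasProjectiveDimensionLT_X₃ (n + 1) hM
        (hasProjectiveDimensionLT_of_ge M (n + 1) (n + 1 + 1) (by omega))
    have h2 := ih (n + 1) (ModuleCat.of B (QuotSMulTop x M)) h1 reg.2
    have h3 := pd_of_iso
      (Submodule.quotOfListConsSMulTopEquivQuotSMulTopInner M x rs).symm.toModuleIso _ h2
    convert h3 using 1
    simp; omega

/-- Let `B` be a commutative ring and `I ⊆ B` an ideal generated by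
a regular sequence of length at most `m + d` (in the geometric situation, `B` is
a polynomial/flat extension and `Spec B/I` is the preimage of a diagonal, cut out
by a regular sequence of length `≤ m + dim G`).  If the restriction of a
`B`-module `M` along this regular sequence is computed in two steps — first an
exact base change (the module being free in the remaining variables
`x_{m+1}, x_{m+2}, …`) and then a Koszul-type restriction of cohomological
amplitude `≤ m + d` — then `Tor_i^B(M, B/I) = 0` for all `i > m + d`. -/
theorem tor_vanishes_above_regular_sequence_length
    (B : Type) [CommRing B] (m d : ℕ)
    (rs : List B) (hreg : RingTheory.Sequence.IsRegular B rs)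
    (hlen : rs.length ≤ m + d)
    (I : Ideal B) (hI : I = Ideal.span {x | x ∈ rs})
    (M : ModuleCat B) (i : ℕ) (hi : m + d < i) :
    IsZero (((Tor (ModuleCat B) i).obj M).obj (ModuleCat.of B (B ⧸ I))) := by
  obtain ⟨k, rfl⟩ : ∃ k, i = k + 1 := ⟨i - 1, by omega⟩
  have hproj : Projective (ModuleCat.of B B) :=
    ModuleCat.projective_of_free (Module.Basis.singleton Unit B)
  have h0 := pd_quot_regular rs 0 (ModuleCat.of B B) inferInstance hreg.toIsWeaklyRegular
  have hI' : Ideal.ofList rs • (⊤ : Submodule B B) = I := by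
    rw [hI, smul_eq_mul, Ideal.mul_top]
  have h1 : HasProjectiveDimensionLT (ModuleCat.of B (B ⧸ I)) (0 + rs.length + 1) :=
    pd_of_iso (Submodule.quotEquivOfEq _ _ hI').toModuleIso _ h0
  have h2 := hasProjectiveDimensionLT_of_ge (ModuleCat.of B (B ⧸ I)) (0 + rs.length + 1) (k + 1) (by omega)
  have : PreservesFiniteColimits ((MonoidalCategory.tensoringLeft (ModuleCat B)).obj M) :=
    inferInstanceAs (PreservesFiniteColimits (MonoidalCategory.tensorLeft M))
  exact isZero_leftDerived_of_pd ((MonoidalCategory.tensoringLeft (ModuleCat B)).obj M) _ k h2
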